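/- Let Φ be an m×N complex matrix with restricted isometry constant δ_{4s}(Φ) ≤ 0.1, let x ∈ ℂ^N and e ∈ ℂ^m be arbitrary, let u = Φx + e, and let (a^k) be the sequence of approximations produced by CoSaMP with sparsity level s. Then for every k ≥ 0, ‖x − a^k‖₂ ≤ 2^{−k}·‖x‖₂ + 20·ν, where ν = ‖x − x_s‖₂ + s^{−1/2}·‖x − x_s‖₁ + ‖e‖₂ is the unrecoverable energy. -/

import Mathlib

open Matrix
open scoped BigOperators Classical

/-- The Euclidean (ℓ₂) norm of a finitely indexed complex vector. -/
noncomputable def l2 {ι : Type*} [Fintype ι] (x : ι → ℂ) : ℝ :=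
  Real.sqrt (∑ i, ‖x i‖ ^ 2)

/-- The ℓ₁ norm of a finitely indexed complex vector. -/
noncomputable def l1 {ι : Type*} [Fintype ι] (x : ι → ℂ) : ℝ := ∑ i, ‖x i‖

/-- The ℓ∞ (supremum) norm of a finitely indexed complex vector. -/
noncomputable def linf {ι : Type*} [Fintype ι] (x : ι → ℂ) : ℝ := ⨆ i, ‖x i‖

/-- The support of a vector, as a finite set of coordinates. -/
noncomputable def suppF {N : ℕ} (x : Fin N → ℂ) : Finset (Fin N) :=
  Finset.univ.filter fun i => x i ≠ 0

/-- A vector is `s`-sparse when it has at most `s` nonzero entries. -/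
def Sparse {N : ℕ} (s : ℕ) (x : Fin N → ℂ) : Prop := (suppF x).card ≤ s

/-- Restriction of a vector to a set `T` of coordinates: equal to `x` on `T`, zero off `T`. -/
noncomputable def restrictTo {N : ℕ} (x : Fin N → ℂ) (T : Finset (Fin N)) : Fin N → ℂ :=
  fun i => if i ∈ T then x i else 0

/-- `y` is a best `s`-sparse approximation of `x`: it agrees with `x` on a set of `s`
coordinates of largest magnitude and vanishes elsewhere. -/
def IsSparseApprox {N : ℕ} (s : ℕ) (x y : Fin N → ℂ) : Prop :=
  ∃ T : Finset (Fin N), T.card = min s N ∧ y = restrictTo x T ∧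
    ∀ i ∈ T, ∀ j ∉ T, ‖x j‖ ≤ ‖x i‖

/-- The `r`-th restricted isometry constant of `Φ`: the least `δ ≥ 0` such that
`(1-δ)‖x‖² ≤ ‖Φx‖² ≤ (1+δ)‖x‖²` for all `r`-sparse `x`. -/
noncomputable def RIC {m N : ℕ} (Φ : Matrix (Fin m) (Fin N) ℂ) (r : ℕ) : ℝ :=
  sInf {δ : ℝ | 0 ≤ δ ∧ ∀ x : Fin N → ℂ, Sparse r x →
    (1 - δ) * l2 x ^ 2 ≤ l2 (Φ.mulVec x) ^ 2 ∧ l2 (Φ.mulVec x) ^ 2 ≤ (1 + δ) * l2 x ^ 2}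

/-- The column submatrix of `Φ` with columns indexed by the finite set `T`. -/
noncomputable def colSub {m N : ℕ} (Φ : Matrix (Fin m) (Fin N) ℂ) (T : Finset (Fin N)) :
    Matrix (Fin m) {i // i ∈ T} ℂ :=
  Matrix.of fun r c => Φ r c.1

/-- The least-squares estimate `Φ_T† u = (Φ_T* Φ_T)⁻¹ Φ_T* u`, viewed as a vector in `ℂ^N`
supported on `T`. -/
noncomputable def pinvApply {m N : ℕ} (Φ : Matrix (Fin m) (Fin N) ℂ) (T : Finset (Fin N))
    (u : Fin m → ℂ) : Fin N → ℂ :=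
  fun j =>
    if h : j ∈ T then (((colSub Φ T)ᴴ * colSub Φ T)⁻¹ * (colSub Φ T)ᴴ).mulVec u ⟨j, h⟩
    else 0

/-- One iteration of CoSaMP with samples `u` and sparsity level `s`, mapping the current
approximation `a` to the next approximation `a'`. -/
def CoSaMPStep {m N : ℕ} (Φ : Matrix (Fin m) (Fin N) ℂ) (u : Fin m → ℂ) (s : ℕ)
    (a a' : Fin N → ℂ) : Prop :=
  ∃ y2s : Fin N → ℂ,
    IsSparseApprox (2 * s) (Φᴴ.mulVec (u - Φ.mulVec a)) y2s ∧
    IsSparseApprox s (pinvApply Φ (suppF y2s ∪ suppF a) u) a'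

/-- `a` is a sequence of approximations produced by CoSaMP: `a 0 = 0` and each successive
approximation arises from one CoSaMP iteration. -/
def CoSaMPSeq {m N : ℕ} (Φ : Matrix (Fin m) (Fin N) ℂ) (u : Fin m → ℂ) (s : ℕ)
    (a : ℕ → Fin N → ℂ) : Prop :=
  a 0 = 0 ∧ ∀ k, CoSaMPStep Φ u s (a k) (a (k + 1))

/-- The spectral norm (ℓ₂ → ℓ₂ operator norm) of a matrix. -/
noncomputable def specNorm {a b : Type*} [Fintype a] [Fintype b] (M : Matrix a b ℂ) : ℝ :=
  sSup ((fun x => l2 (M.mulVec x)) '' {x | l2 x ≤ 1})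

theorem l2_eq_norm {ι : Type*} [Fintype ι] (x : ι → ℂ) : l2 x = ‖WithLp.toLp 2 x‖ := by
  rw [EuclideanSpace.norm_eq]; rfl

theorem l2_nonneg {ι : Type*} [Fintype ι] (x : ι → ℂ) : 0 ≤ l2 x := Real.sqrt_nonneg _

theorem l2_sq {ι : Type*} [Fintype ι] (x : ι → ℂ) : l2 x ^ 2 = ∑ i, ‖x i‖ ^ 2 :=
  Real.sq_sqrt (Finset.sum_nonneg fun _ _ => sq_nonneg _)

theorem l2_zero {ι : Type*} [Fintype ι] : l2 (0 : ι → ℂ) = 0 := by simp [l2]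

theorem l2_add_le {ι : Type*} [Fintype ι] (x y : ι → ℂ) : l2 (x + y) ≤ l2 x + l2 y := by
  simpa only [l2_eq_norm, WithLp.toLp_add] using norm_add_le _ _

theorem l2_sub_le {ι : Type*} [Fintype ι] (x y : ι → ℂ) : l2 (x - y) ≤ l2 x + l2 y := by
  simpa only [l2_eq_norm, WithLp.toLp_sub] using norm_sub_le _ _

theorem l2_eq_zero {ι : Type*} [Fintype ι] {x : ι → ℂ} (h : l2 x = 0) : x = 0 := by
  rw [l2_eq_norm, norm_eq_zero] at h
  simpa using h

theorem l2_smul {ι : Type*} [Fintype ι] (c : ℂ) (x : ι → ℂ) : l2 (c • x) = ‖c‖ * l2 x := by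
  simpa only [l2_eq_norm, WithLp.toLp_smul] using norm_smul _ _

theorem l2_sub_rev {ι : Type*} [Fintype ι] (x y : ι → ℂ) : l2 (x - y) = l2 (y - x) := by
  simpa only [l2_eq_norm, WithLp.toLp_sub] using norm_sub_rev _ _

/-- Polarization of the squared norm. -/
theorem l2_add_sq_sub_l2_sub_sq {ι : Type*} [Fintype ι] (x y : ι → ℂ) :
    l2 (x + y) ^ 2 - l2 (x - y) ^ 2 = 4 * (star x ⬝ᵥ y).re := by
  simp only [l2_sq, dotProduct, Complex.re_sum, Finset.mul_sum, ← Finset.sum_sub_distrib]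
  refine Finset.sum_congr rfl fun i _ => ?_
  simp [← Complex.normSq_eq_norm_sq, Complex.normSq_apply]
  ring

theorem l2_add_sq_add_l2_sub_sq {ι : Type*} [Fintype ι] (x y : ι → ℂ) :
    l2 (x + y) ^ 2 + l2 (x - y) ^ 2 = 2 * (l2 x ^ 2 + l2 y ^ 2) := by
  simp only [l2_sq, Finset.mul_sum, ← Finset.sum_add_distrib]
  refine Finset.sum_congr rfl fun i _ => ?_
  simp [← Complex.normSq_eq_norm_sq, Complex.normSq_apply]
  ring

theorem re_star_dotProduct_le {ι : Type*} [Fintype ι] (x y : ι → ℂ) :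
    (star x ⬝ᵥ y).re ≤ l2 x * l2 y := by
  have h := re_inner_le_norm (𝕜 := ℂ) (WithLp.toLp 2 x) (WithLp.toLp 2 y)
  rw [← l2_eq_norm, ← l2_eq_norm, EuclideanSpace.inner_eq_star_dotProduct, dotProduct_comm] at h
  exact h

theorem re_star_restrictTo_dotProduct {N : ℕ} (x : Fin N → ℂ) (T : Finset (Fin N)) :
    (star (restrictTo x T) ⬝ᵥ x).re = l2 (restrictTo x T) ^ 2 := by
  simp only [l2_sq, dotProduct, Complex.re_sum]
  refine Finset.sum_congr rfl fun i _ => ?_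
  by_cases h : i ∈ T <;>
    simp [restrictTo, h, ← Complex.normSq_eq_norm_sq, Complex.normSq_apply]

theorem l2_restrictTo_sq {N : ℕ} (x : Fin N → ℂ) (T : Finset (Fin N)) :
    l2 (restrictTo x T) ^ 2 = ∑ i ∈ T, ‖x i‖ ^ 2 := by
  rw [l2_sq, ← Finset.sum_subset (Finset.subset_univ T)]
  · exact Finset.sum_congr rfl fun i hi => by simp [restrictTo, hi]
  · intro i _ hi
    simp [restrictTo, hi]

theorem l2_mono {ι : Type*} [Fintype ι] {x y : ι → ℂ} (h : ∀ i, ‖x i‖ ≤ ‖y i‖) :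
    l2 x ≤ l2 y :=
  Real.sqrt_le_sqrt (Finset.sum_le_sum fun i _ => by have := h i; gcongr)

theorem l2_restrictTo_le {N : ℕ} (x : Fin N → ℂ) (T : Finset (Fin N)) :
    l2 (restrictTo x T) ≤ l2 x :=
  l2_mono fun i => by by_cases h : i ∈ T <;> simp [restrictTo, h]

theorem restrictTo_add {N : ℕ} (x y : Fin N → ℂ) (T : Finset (Fin N)) :
    restrictTo (x + y) T = restrictTo x T + restrictTo y T := by
  ext i; by_cases h : i ∈ T <;> simp [restrictTo, h]

theorem restrictTo_sub {N : ℕ} (x y : Fin N → ℂ) (T : Finset (Fin N)) :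
    restrictTo (x - y) T = restrictTo x T - restrictTo y T := by
  ext i; by_cases h : i ∈ T <;> simp [restrictTo, h]

theorem restrictTo_add_compl {N : ℕ} (x : Fin N → ℂ) (T : Finset (Fin N)) :
    restrictTo x T + restrictTo x Tᶜ = x := by
  ext i; by_cases h : i ∈ T <;> simp [restrictTo, h]

theorem mem_suppF {N : ℕ} {x : Fin N → ℂ} {i : Fin N} : i ∈ suppF x ↔ x i ≠ 0 := by
  simp [suppF]

theorem suppF_subset_iff {N : ℕ} {x : Fin N → ℂ} {T : Finset (Fin N)} :
    suppF x ⊆ T ↔ ∀ i ∉ T, x i = 0 := by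
  simp only [Finset.subset_iff, mem_suppF]
  exact forall_congr' fun i => not_imp_comm

theorem suppF_restrictTo_subset {N : ℕ} (x : Fin N → ℂ) (T : Finset (Fin N)) :
    suppF (restrictTo x T) ⊆ T :=
  suppF_subset_iff.2 fun i hi => by simp [restrictTo, hi]

theorem suppF_add_subset {N : ℕ} (x y : Fin N → ℂ) : suppF (x + y) ⊆ suppF x ∪ suppF y :=
  suppF_subset_iff.2 fun i hi => by
    simp only [Finset.mem_union, mem_suppF, not_or, not_not] at hi
    simp [hi.1, hi.2]

theorem suppF_sub_subset {N : ℕ} (x y : Fin N → ℂ) : suppF (x - y) ⊆ suppF x ∪ suppF y :=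
  suppF_subset_iff.2 fun i hi => by
    simp only [Finset.mem_union, mem_suppF, not_or, not_not] at hi
    simp [hi.1, hi.2]

theorem Sparse.of_suppF_subset {N s : ℕ} {x : Fin N → ℂ} {T : Finset (Fin N)}
    (h : suppF x ⊆ T) (hT : T.card ≤ s) : Sparse s x :=
  (Finset.card_le_card h).trans hT

theorem IsSparseApprox.sparse {N s : ℕ} {x y : Fin N → ℂ} (h : IsSparseApprox s x y) :
    Sparse s y := by
  obtain ⟨T, hT, rfl, -⟩ := h
  exact .of_suppF_subset (suppF_restrictTo_subset x T) (hT ▸ min_le_left _ _)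

theorem sum_sdiff_le_sum_sdiff_of_card_le {ι : Type*} [DecidableEq ι] {f : ι → ℝ} {S T : Finset ι}
    (hf : ∀ i, 0 ≤ f i) (hT : ∀ i ∈ T, ∀ j ∉ T, f j ≤ f i) (hc : S.card ≤ T.card) :
    ∑ i ∈ S \ T, f i ≤ ∑ i ∈ T \ S, f i := by
  have hcard : (S \ T).card ≤ (T \ S).card := by
    have h1 := Finset.card_sdiff_add_card_inter S T
    have h2 := Finset.card_sdiff_add_card_inter T S
    rw [Finset.inter_comm] at h2
    omega
  rcases (S \ T).eq_empty_or_nonempty with h | h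
  · rw [h, Finset.sum_empty]
    exact Finset.sum_nonneg fun i _ => hf i
  · obtain ⟨j, hj, hmax⟩ := Finset.exists_max_image (S \ T) f h
    calc ∑ i ∈ S \ T, f i ≤ (S \ T).card • f j := Finset.sum_le_card_nsmul _ _ _ hmax
      _ ≤ (T \ S).card • f j := nsmul_le_nsmul_left (hf j) hcard
      _ ≤ ∑ i ∈ T \ S, f i := Finset.card_nsmul_le_sum _ _ _ fun i hi =>
          hT i (Finset.mem_sdiff.1 hi).1 j (Finset.mem_sdiff.1 hj).2

theorem exists_isSparseApprox {N : ℕ} (s : ℕ) (x : Fin N → ℂ) : ∃ y, IsSparseApprox s x y := by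
  suffices h : ∀ r ≤ N, ∃ T : Finset (Fin N), T.card = r ∧ ∀ i ∈ T, ∀ j ∉ T, ‖x j‖ ≤ ‖x i‖ by
    obtain ⟨T, hT, hmax⟩ := h (min s N) (min_le_right _ _)
    exact ⟨_, T, hT, rfl, hmax⟩
  intro r
  induction r with
  | zero => exact fun _ => ⟨∅, by simp⟩
  | succ r ih =>
    intro hr
    obtain ⟨T, hT, hmax⟩ := ih (by omega)
    have hne : (Tᶜ).Nonempty := by
      rw [← Finset.card_pos, Finset.card_compl, Fintype.card_fin]
      omega
    obtain ⟨k, hk, hkmax⟩ := Finset.exists_max_image Tᶜ (fun i => ‖x i‖) hne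
    rw [Finset.mem_compl] at hk
    refine ⟨insert k T, by rw [Finset.card_insert_of_notMem hk, hT], ?_⟩
    intro i hi j hj
    rw [Finset.mem_insert, not_or] at hj
    rcases Finset.mem_insert.1 hi with rfl | hi
    · exact hkmax j (Finset.mem_compl.2 hj.2)
    · exact hmax i hi j hj.2

/-- A best `s`-sparse approximation is at least as close as any other `s`-sparse vector. -/
theorem IsSparseApprox.l2_sub_le {N s : ℕ} {x y z : Fin N → ℂ} (h : IsSparseApprox s x y)
    (hz : Sparse s z) : l2 (x - y) ≤ l2 (x - z) := by
  obtain ⟨T, hT, rfl, hmax⟩ := h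
  have hx : x - restrictTo x T = restrictTo x Tᶜ :=
    sub_eq_of_eq_add' (restrictTo_add_compl x T).symm
  have hzc : l2 (restrictTo x (suppF z)ᶜ) ≤ l2 (x - z) := by
    refine l2_mono fun i => ?_
    by_cases hi : z i = 0 <;> simp [restrictTo, mem_suppF, hi]
  refine le_trans ?_ hzc
  rw [hx]
  refine abs_le_of_sq_le_sq' ?_ (l2_nonneg _) |>.2
  rw [l2_restrictTo_sq, l2_restrictTo_sq]
  have hle := sum_sdiff_le_sum_sdiff_of_card_le (f := fun i => ‖x i‖ ^ 2) (S := suppF z) (T := T)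
    (fun i => sq_nonneg _) (fun i hi j hj => by have := hmax i hi j hj; gcongr)
    (hT ▸ le_min hz (card_finset_fin_le _))
  have hS := Finset.sum_inter_add_sum_sdiff (suppF z) T fun i => ‖x i‖ ^ 2
  have hT' := Finset.sum_inter_add_sum_sdiff T (suppF z) fun i => ‖x i‖ ^ 2
  rw [Finset.inter_comm] at hT'
  have hSc := Finset.sum_add_sum_compl (suppF z) fun i => ‖x i‖ ^ 2
  have hTc := Finset.sum_add_sum_compl T fun i => ‖x i‖ ^ 2
  linarith

/-- `Φ` satisfies the restricted isometry inequalities on `r`-sparse vectors with constant `δ`. -/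
def HasRIP {m N : ℕ} (Φ : Matrix (Fin m) (Fin N) ℂ) (r : ℕ) (δ : ℝ) : Prop :=
  ∀ x : Fin N → ℂ, Sparse r x →
    (1 - δ) * l2 x ^ 2 ≤ l2 (Φ.mulVec x) ^ 2 ∧ l2 (Φ.mulVec x) ^ 2 ≤ (1 + δ) * l2 x ^ 2

theorem exists_l2_mulVec_sq_le {m N : ℕ} (Φ : Matrix (Fin m) (Fin N) ℂ) :
    ∃ C : ℝ, 0 ≤ C ∧ ∀ x, l2 (Φ.mulVec x) ^ 2 ≤ C * l2 x ^ 2 := by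
  refine ⟨∑ i, ∑ j, ‖Φ i j‖ ^ 2, by positivity, fun x => ?_⟩
  rw [l2_sq, l2_sq, Finset.sum_mul]
  refine Finset.sum_le_sum fun i _ => ?_
  calc ‖Φ.mulVec x i‖ ^ 2 ≤ (∑ j, ‖Φ i j‖ * ‖x j‖) ^ 2 := by
        gcongr
        exact (norm_sum_le _ _).trans (Finset.sum_le_sum fun j _ =>
          (norm_mul (Φ i j) (x j)).le)
    _ ≤ _ := Finset.sum_mul_sq_le_sq_mul_sq _ _ _

theorem HasRIP.of_RIC_le {m N r : ℕ} {Φ : Matrix (Fin m) (Fin N) ℂ} {δ : ℝ}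
    (h : RIC Φ r ≤ δ) : HasRIP Φ r δ := by
  have hne : {δ : ℝ | 0 ≤ δ ∧ HasRIP Φ r δ}.Nonempty := by
    obtain ⟨C, hC, hΦ⟩ := exists_l2_mulVec_sq_le Φ
    refine ⟨1 + C, by positivity, fun x _ => ⟨?_, ?_⟩⟩
    · nlinarith [sq_nonneg (l2 x), sq_nonneg (l2 (Φ.mulVec x)), mul_nonneg hC (sq_nonneg (l2 x))]
    · nlinarith [sq_nonneg (l2 x), hΦ x]
  have key : ∀ ε > 0, HasRIP Φ r (δ + ε) := by
    intro ε hε x hx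
    obtain ⟨η, ⟨-, hη⟩, hlt⟩ := exists_lt_of_csInf_lt hne (h.trans_lt (lt_add_of_pos_right δ hε))
    have := sq_nonneg (l2 x)
    constructor <;> nlinarith [hη x hx]
  intro x hx
  have hcont : ∀ c : ℝ, Filter.Tendsto (fun ε : ℝ => c * (δ + ε)) (nhdsWithin 0 (Set.Ioi 0))
      (nhds (c * δ)) := fun c => by
    have : Continuous fun ε : ℝ => c * (δ + ε) := by fun_prop
    simpa using (this.tendsto 0).mono_left nhdsWithin_le_nhds
  have h1 := ge_of_tendsto (b := l2 x ^ 2 - l2 (Φ.mulVec x) ^ 2) (hcont (l2 x ^ 2)) <| by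
    filter_upwards [self_mem_nhdsWithin] with ε hε
    linarith [(key ε hε x hx).1]
  have h2 := ge_of_tendsto (b := l2 (Φ.mulVec x) ^ 2 - l2 x ^ 2) (hcont (l2 x ^ 2)) <| by
    filter_upwards [self_mem_nhdsWithin] with ε hε
    linarith [(key ε hε x hx).2]
  constructor <;> linarith

theorem star_dotProduct_conjTranspose_mulVec {m N : ℕ} (Φ : Matrix (Fin m) (Fin N) ℂ)
    (v : Fin N → ℂ) (w : Fin m → ℂ) :
    star v ⬝ᵥ Φᴴ.mulVec w = star (Φ.mulVec v) ⬝ᵥ w := by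
  rw [star_mulVec, dotProduct_mulVec]

/-- Restricted near-isometries satisfy `‖((I - Φ*Φ) w)|_A‖ ≤ δ ‖w‖` when `A` and the support of
`w` lie in a common set of size at most `r`. -/
theorem HasRIP.l2_restrictTo_sub_le {m N r : ℕ} {Φ : Matrix (Fin m) (Fin N) ℂ} {δ : ℝ}
    (h : HasRIP Φ r δ) (hδ : 0 < δ) {w : Fin N → ℂ} {A B : Finset (Fin N)} (hA : A ⊆ B)
    (hw : suppF w ⊆ B) (hB : B.card ≤ r) :
    l2 (restrictTo (w - Φᴴ.mulVec (Φ.mulVec w)) A) ≤ δ * l2 w := by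
  set g := w - Φᴴ.mulVec (Φ.mulVec w) with hg
  set v := restrictTo g A with hv
  have hvB : suppF v ⊆ B := (suppF_restrictTo_subset g A).trans hA
  have hwB : suppF ((δ : ℂ) • w) ⊆ B := by
    rw [suppF_subset_iff] at hw ⊢
    intro i hi
    simp [hw i hi]
  have hadd := (h (v + (δ : ℂ) • w) (.of_suppF_subset
    ((suppF_add_subset _ _).trans (Finset.union_subset hvB hwB)) hB)).1
  have hsub := (h (v - (δ : ℂ) • w) (.of_suppF_subset
    ((suppF_sub_subset _ _).trans (Finset.union_subset hvB hwB)) hB)).2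
  have hsq : l2 v ^ 2 = (star v ⬝ᵥ w).re - (star (Φ.mulVec v) ⬝ᵥ Φ.mulVec w).re := by
    rw [hv, ← re_star_restrictTo_dotProduct, ← hv, hg, dotProduct_sub,
      star_dotProduct_conjTranspose_mulVec, Complex.sub_re]
  have h1 := l2_add_sq_sub_l2_sub_sq v ((δ : ℂ) • w)
  have h2 := l2_add_sq_sub_l2_sub_sq (Φ.mulVec v) (Φ.mulVec ((δ : ℂ) • w))
  have h3 := l2_add_sq_add_l2_sub_sq v ((δ : ℂ) • w)
  rw [← mulVec_add, ← mulVec_sub, mulVec_smul, dotProduct_smul, smul_eq_mul,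
    Complex.re_ofReal_mul] at h2
  rw [dotProduct_smul, smul_eq_mul, Complex.re_ofReal_mul] at h1
  rw [l2_smul, Complex.norm_real, Real.norm_eq_abs, abs_of_pos hδ] at h3
  refine abs_le_of_sq_le_sq' ?_ (mul_nonneg hδ.le (l2_nonneg w)) |>.2
  refine le_of_mul_le_mul_left (a := 2 * δ) ?_ (by positivity)
  have h4 : 4 * (δ * l2 v ^ 2) ≤ δ * (2 * (l2 v ^ 2 + (δ * l2 w) ^ 2)) := by
    rw [hsq, mul_sub, ← hsq, ← h3]
    linarith
  linarith

theorem HasRIP.l2_mulVec_le {m N r : ℕ} {Φ : Matrix (Fin m) (Fin N) ℂ} {δ K : ℝ}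
    (h : HasRIP Φ r δ) (hK : 0 ≤ K) (hδK : 1 + δ ≤ K ^ 2) {x : Fin N → ℂ} (hx : Sparse r x) :
    l2 (Φ.mulVec x) ≤ K * l2 x := by
  refine abs_le_of_sq_le_sq' ?_ (mul_nonneg hK (l2_nonneg x)) |>.2
  rw [mul_pow]
  exact (h x hx).2.trans (by gcongr)

theorem HasRIP.l2_restrictTo_conjTranspose_mulVec_le {m N r : ℕ}
    {Φ : Matrix (Fin m) (Fin N) ℂ} {δ K : ℝ} (h : HasRIP Φ r δ) (hK : 0 ≤ K)
    (hδK : 1 + δ ≤ K ^ 2) (e : Fin m → ℂ) {A : Finset (Fin N)} (hA : A.card ≤ r) :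
    l2 (restrictTo (Φᴴ.mulVec e) A) ≤ K * l2 e := by
  set v := restrictTo (Φᴴ.mulVec e) A with hv
  have hsq : l2 v ^ 2 ≤ K * l2 v * l2 e := by
    rw [hv, ← re_star_restrictTo_dotProduct, star_dotProduct_conjTranspose_mulVec, ← hv]
    refine (re_star_dotProduct_le _ _).trans ?_
    gcongr
    · exact l2_nonneg e
    · exact h.l2_mulVec_le hK hδK (.of_suppF_subset (suppF_restrictTo_subset _ _) hA)
  rcases (l2_nonneg v).eq_or_lt with h0 | h0
  · rw [← h0]
    exact mul_nonneg hK (l2_nonneg e)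
  · nlinarith

theorem l1_nonneg {ι : Type*} [Fintype ι] (x : ι → ℂ) : 0 ≤ l1 x :=
  Finset.sum_nonneg fun _ _ => norm_nonneg _

theorem l1_eq_sum_add_l1_restrictTo_compl {N : ℕ} (x : Fin N → ℂ) (T : Finset (Fin N)) :
    l1 x = ∑ i ∈ T, ‖x i‖ + l1 (restrictTo x Tᶜ) := by
  rw [l1, ← Finset.sum_add_sum_compl T, l1, add_right_inj,
    ← Finset.sum_subset (Finset.subset_univ Tᶜ)]
  · exact Finset.sum_congr rfl fun i hi => by simp [restrictTo, Finset.mem_compl.1 hi]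
  · intro i _ hi
    rw [restrictTo, if_neg hi, norm_zero]

/-- The energy bound `‖Φx‖₂ ≤ K (‖x‖₂ + ‖x‖₁ / √s)`, with `‖x‖₂` sharpened to the norm of a best
`s`-sparse approximation. -/
theorem HasRIP.l2_mulVec_le_of_isSparseApprox {m N s : ℕ} (hs : 0 < s)
    {Φ : Matrix (Fin m) (Fin N) ℂ} {δ K : ℝ} (h : HasRIP Φ s δ) (hK : 0 ≤ K)
    (hδK : 1 + δ ≤ K ^ 2) {x w : Fin N → ℂ} (hw : IsSparseApprox s x w) :
    l2 (Φ.mulVec x) ≤ K * (l2 w + (Real.sqrt s)⁻¹ * l1 x) := by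
  induction hn : (suppF x).card using Nat.strong_induction_on generalizing x w with
  | _ n ih =>
  have hΦw := h.l2_mulVec_le hK hδK hw.sparse
  obtain ⟨T, hT, rfl, hmax⟩ := hw
  obtain ⟨w', hw'⟩ := exists_isSparseApprox s (restrictTo x Tᶜ)
  have hs0 : (0 : ℝ) < Real.sqrt s := Real.sqrt_pos.2 (by exact_mod_cast hs)
  by_cases hz : restrictTo x Tᶜ = 0
  · have hx : restrictTo x T = x := by simpa [hz] using restrictTo_add_compl x T
    rw [hx] at hΦw ⊢
    refine hΦw.trans ?_
    gcongr
    exact le_add_of_nonneg_right (mul_nonneg (inv_nonneg.2 hs0.le) (l1_nonneg x))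
  · obtain ⟨j, hj⟩ := Function.ne_iff.1 hz
    have hjT : j ∉ T := fun hjT => hj (by simp [restrictTo, hjT])
    have hTs : T.card = s := by
      rw [hT, min_eq_left]
      by_contra! hlt
      have : T = Finset.univ := by
        rw [← Finset.card_eq_iff_eq_univ, hT, min_eq_right hlt.le, Fintype.card_fin]
      exact hjT (this ▸ Finset.mem_univ j)
    have hTne : T.Nonempty := Finset.card_pos.1 (hTs ▸ hs)
    obtain ⟨k, hk, hkmin⟩ := Finset.exists_min_image T (fun i => ‖x i‖) hTne
    have hxj : x j ≠ 0 := by simpa [restrictTo, hjT] using hj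
    have hxk : x k ≠ 0 := norm_pos_iff.1 ((norm_pos_iff.2 hxj).trans_le (hmax k hk j hjT))
    have hcard : (suppF (restrictTo x Tᶜ)).card < n := by
      rw [← hn]
      refine Finset.card_lt_card (Finset.ssubset_iff_of_subset ?_ |>.2
        ⟨k, mem_suppF.2 hxk, by simp [mem_suppF, restrictTo, hk]⟩)
      intro i
      rw [mem_suppF, mem_suppF, restrictTo]
      exact fun hi h0 => hi (by rw [h0, ite_self])
    have hrest := ih _ hcard hw' rfl
    have hl2 : l2 w' ≤ Real.sqrt s * ‖x k‖ := by
      obtain ⟨T', hT', rfl, -⟩ := hw'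
      refine abs_le_of_sq_le_sq' ?_ (by positivity) |>.2
      rw [l2_restrictTo_sq, mul_pow, Real.sq_sqrt (Nat.cast_nonneg s)]
      calc ∑ i ∈ T', ‖restrictTo x Tᶜ i‖ ^ 2 ≤ T'.card • ‖x k‖ ^ 2 := by
            refine Finset.sum_le_card_nsmul _ _ _ fun i _ => ?_
            by_cases hi : i ∈ T
            · simp [restrictTo, hi]
            · simpa [restrictTo, hi] using pow_le_pow_left₀ (norm_nonneg _) (hmax k hk i hi) 2
        _ ≤ s * ‖x k‖ ^ 2 := by
            rw [nsmul_eq_mul]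
            gcongr
            exact hT' ▸ min_le_left _ _
    have hl1 : s * ‖x k‖ ≤ ∑ i ∈ T, ‖x i‖ := by
      simpa [hTs] using Finset.card_nsmul_le_sum T _ _ hkmin
    have hl2' : l2 w' ≤ (Real.sqrt s)⁻¹ * ∑ i ∈ T, ‖x i‖ := by
      refine hl2.trans ?_
      rw [inv_mul_eq_div, le_div_iff₀ hs0]
      calc _ = (Real.sqrt s * Real.sqrt s) * ‖x k‖ := by ring
        _ ≤ _ := by rwa [Real.mul_self_sqrt (Nat.cast_nonneg s)]
    calc l2 (Φ.mulVec x)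
        = l2 (Φ.mulVec (restrictTo x T) + Φ.mulVec (restrictTo x Tᶜ)) := by
          rw [← mulVec_add, restrictTo_add_compl]
      _ ≤ _ := l2_add_le _ _
      _ ≤ K * l2 (restrictTo x T) +
          K * ((Real.sqrt s)⁻¹ * ∑ i ∈ T, ‖x i‖ + (Real.sqrt s)⁻¹ * l1 (restrictTo x Tᶜ)) := by
          refine add_le_add hΦw (hrest.trans ?_)
          gcongr
      _ = _ := by
          rw [l1_eq_sum_add_l1_restrictTo_compl x T]
          ring

theorem HasRIP.mono {m N r r' : ℕ} {Φ : Matrix (Fin m) (Fin N) ℂ} {δ : ℝ} (h : HasRIP Φ r δ)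
    (hr : r' ≤ r) : HasRIP Φ r' δ :=
  fun x hx => h x (hx.trans hr)

theorem HasRIP.l2_mulVec_le_l2_add_l1 {m N s : ℕ} (hs : 0 < s)
    {Φ : Matrix (Fin m) (Fin N) ℂ} {δ K : ℝ} (h : HasRIP Φ s δ) (hK : 0 ≤ K)
    (hδK : 1 + δ ≤ K ^ 2) (x : Fin N → ℂ) :
    l2 (Φ.mulVec x) ≤ K * (l2 x + (Real.sqrt s)⁻¹ * l1 x) := by
  obtain ⟨w, hw⟩ := exists_isSparseApprox s x
  refine (h.l2_mulVec_le_of_isSparseApprox hs hK hδK hw).trans ?_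
  obtain ⟨T, -, rfl, -⟩ := hw
  gcongr
  exact l2_restrictTo_le x T

theorem mulVec_eq_colSub_mulVec {m N : ℕ} (Φ : Matrix (Fin m) (Fin N) ℂ) {T : Finset (Fin N)}
    {x : Fin N → ℂ} (hx : suppF x ⊆ T) :
    Φ.mulVec x = (colSub Φ T).mulVec fun i => x i.1 := by
  ext r
  simp only [mulVec, dotProduct, colSub, of_apply]
  rw [Finset.sum_coe_sort T fun i => Φ r i * x i]
  refine (Finset.sum_subset (Finset.subset_univ T) fun i _ hi => ?_).symm
  rw [suppF_subset_iff.1 hx i hi, mul_zero]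

theorem HasRIP.colSub_mulVec_injective {m N r : ℕ} {Φ : Matrix (Fin m) (Fin N) ℂ} {δ : ℝ}
    (h : HasRIP Φ r δ) (hδ : δ < 1) {T : Finset (Fin N)} (hT : T.card ≤ r) :
    Function.Injective (colSub Φ T).mulVec := by
  rw [← coe_mulVecLin, injective_iff_map_eq_zero]
  intro y hy
  set x : Fin N → ℂ := fun i => if hi : i ∈ T then y ⟨i, hi⟩ else 0 with hx
  have hxT : suppF x ⊆ T := suppF_subset_iff.2 fun i hi => by simp [hx, hi]
  have hΦx : Φ.mulVec x = 0 := by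
    rw [mulVec_eq_colSub_mulVec Φ hxT, ← hy, mulVecLin_apply]
    congr 1
    ext i
    simp [hx]
  have hle := (h x (.of_suppF_subset hxT hT)).1
  rw [hΦx, l2_zero] at hle
  have hx0 : x = 0 := l2_eq_zero (pow_eq_zero_iff two_ne_zero |>.1
    (le_antisymm (by nlinarith [sq_nonneg (l2 x)]) (sq_nonneg _)))
  ext i
  simpa [hx] using congrFun hx0 i

theorem suppF_pinvApply_subset {m N : ℕ} (Φ : Matrix (Fin m) (Fin N) ℂ) (T : Finset (Fin N))
    (u : Fin m → ℂ) : suppF (pinvApply Φ T u) ⊆ T :=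
  suppF_subset_iff.2 fun i hi => by simp [pinvApply, hi]

open scoped ComplexOrder in
/-- The residual of the least-squares estimate is orthogonal to the columns indexed by `T`. -/
theorem HasRIP.restrictTo_conjTranspose_mulVec_residual {m N r : ℕ}
    {Φ : Matrix (Fin m) (Fin N) ℂ} {δ : ℝ} (h : HasRIP Φ r δ) (hδ : δ < 1)
    {T : Finset (Fin N)} (hT : T.card ≤ r) (u : Fin m → ℂ) :
    restrictTo (Φᴴ.mulVec (u - Φ.mulVec (pinvApply Φ T u))) T = 0 := by
  have hunit : IsUnit ((colSub Φ T)ᴴ * colSub Φ T) := by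
    rw [← mulVec_injective_iff_isUnit, ← coe_mulVecLin, injective_iff_map_eq_zero]
    intro y hy
    rw [mulVecLin_apply, conjTranspose_mul_self_mulVec_eq_zero] at hy
    exact h.colSub_mulVec_injective hδ hT (by rw [hy, mulVec_zero])
  have hnormal : (colSub Φ T)ᴴ.mulVec (u - Φ.mulVec (pinvApply Φ T u)) = 0 := by
    have hb : (fun i : {i // i ∈ T} => pinvApply Φ T u i.1) =
        (((colSub Φ T)ᴴ * colSub Φ T)⁻¹ * (colSub Φ T)ᴴ).mulVec u := by
      ext i
      simp [pinvApply]
    rw [mulVec_eq_colSub_mulVec Φ (suppF_pinvApply_subset Φ T u), hb, mulVec_sub, mulVec_mulVec,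
      mulVec_mulVec, ← Matrix.mul_assoc,
      mul_nonsing_inv _ ((isUnit_iff_isUnit_det _).1 hunit), Matrix.one_mul, sub_self]
  ext i
  by_cases hi : i ∈ T
  · rw [restrictTo, if_pos hi]
    exact congrFun hnormal ⟨i, hi⟩
  · simp [restrictTo, hi]

theorem l2_le_l2_restrictTo_add {N : ℕ} (x : Fin N → ℂ) (T : Finset (Fin N)) :
    l2 x ≤ l2 (restrictTo x T) + l2 (restrictTo x Tᶜ) := by
  simpa only [restrictTo_add_compl] using l2_add_le (restrictTo x T) (restrictTo x Tᶜ)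

/-- The coordinates selected from the signal proxy capture most of the energy of the residual
signal `z`. -/
theorem HasRIP.l2_restrictTo_compl_suppF_le {m N s : ℕ} {Φ : Matrix (Fin m) (Fin N) ℂ}
    {δ K : ℝ} (h : HasRIP Φ (4 * s) δ) (hδ : 0 < δ) (hK : 0 ≤ K) (hδK : 1 + δ ≤ K ^ 2)
    {z y : Fin N → ℂ} (hz : Sparse (2 * s) z) (e : Fin m → ℂ)
    (hy : IsSparseApprox (2 * s) (Φᴴ.mulVec (Φ.mulVec z + e)) y) :
    l2 (restrictTo z (suppF y)ᶜ) ≤ 2 * (δ * l2 z + K * l2 e) := by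
  obtain ⟨T, hT, rfl, hmax⟩ := hy
  set p := Φᴴ.mulVec (Φ.mulVec z + e) with hp
  set R := suppF z with hR
  set Ω := suppF (restrictTo p T) with hΩ
  have hTs : T.card ≤ 2 * s := hT ▸ min_le_left _ _
  have hΩT : Ω ⊆ T := suppF_restrictTo_subset p T
  have hcard : (R ∪ T).card ≤ 4 * s := (Finset.card_union_le R T).trans (by
    have : R.card ≤ 2 * s := hz
    omega)
  have herr : ∀ A ⊆ R ∪ T, l2 (restrictTo (z - p) A) ≤ δ * l2 z + K * l2 e := by
    intro A hA
    have hzp : z - p = (z - Φᴴ.mulVec (Φ.mulVec z)) - Φᴴ.mulVec e := by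
      rw [hp, mulVec_add, sub_sub]
    rw [hzp, restrictTo_sub]
    exact (l2_sub_le _ _).trans (add_le_add
      (h.l2_restrictTo_sub_le hδ hA Finset.subset_union_left hcard)
      (h.l2_restrictTo_conjTranspose_mulVec_le hK hδK e ((Finset.card_le_card hA).trans hcard)))
  have hpΩ : l2 (restrictTo p (R \ Ω)) ≤ l2 (restrictTo p (T \ R)) := by
    refine abs_le_of_sq_le_sq' ?_ (l2_nonneg _) |>.2
    rw [l2_restrictTo_sq, l2_restrictTo_sq,
      ← Finset.sum_subset (Finset.sdiff_subset_sdiff subset_rfl hΩT)]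
    · exact sum_sdiff_le_sum_sdiff_of_card_le (f := fun i => ‖p i‖ ^ 2) (fun i => sq_nonneg _)
        (fun i hi j hj => by have := hmax i hi j hj; gcongr)
        (hT ▸ le_min hz (card_finset_fin_le _))
    · intro i hi hi'
      rw [Finset.mem_sdiff] at hi hi'
      have hiT : i ∈ T := by tauto
      have : p i = 0 := by simpa [hΩ, mem_suppF, restrictTo, hiT] using hi.2
      simp [this]
  have hzR : restrictTo z Ωᶜ = restrictTo (z - p) (R \ Ω) + restrictTo p (R \ Ω) := by
    rw [← restrictTo_add, sub_add_cancel]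
    ext i
    by_cases hi : z i = 0 <;> simp [restrictTo, hR, mem_suppF, hi]
  have hpT : restrictTo p (T \ R) = 0 - restrictTo (z - p) (T \ R) := by
    ext i
    by_cases hi : z i = 0 <;> simp [restrictTo, hR, mem_suppF, hi]
    split_ifs <;> simp
  rw [hpT, l2_sub_rev, sub_zero] at hpΩ
  have h1 := herr (R \ Ω) (Finset.sdiff_subset.trans Finset.subset_union_left)
  have h2 := herr (T \ R) (Finset.sdiff_subset.trans Finset.subset_union_right)
  rw [hzR]
  linarith [l2_add_le (restrictTo (z - p) (R \ Ω)) (restrictTo p (R \ Ω))]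

/-- The least-squares estimate on `T` is nearly as good as the restriction of the signal to `T`. -/
theorem HasRIP.l2_sub_pinvApply_le {m N r : ℕ} {Φ : Matrix (Fin m) (Fin N) ℂ}
    {δ K : ℝ} (h : HasRIP Φ r δ) (hδ : 0 < δ) (hδ1 : δ < 1) (hK : 0 ≤ K) (hδK : 1 + δ ≤ K ^ 2)
    {z : Fin N → ℂ} {T : Finset (Fin N)} (hzT : (suppF z ∪ T).card ≤ r) (e : Fin m → ℂ) :
    (1 - δ) * l2 (z - pinvApply Φ T (Φ.mulVec z + e)) ≤ l2 (restrictTo z Tᶜ) + K * l2 e := by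
  set b := pinvApply Φ T (Φ.mulVec z + e) with hb
  have hT : T.card ≤ r := (Finset.card_le_card Finset.subset_union_right).trans hzT
  have hbT : suppF b ⊆ T := suppF_pinvApply_subset Φ T _
  have horth : restrictTo (Φᴴ.mulVec (Φ.mulVec (z - b))) T + restrictTo (Φᴴ.mulVec e) T = 0 := by
    rw [← restrictTo_add, ← mulVec_add, mulVec_sub, sub_add_eq_add_sub]
    exact h.restrictTo_conjTranspose_mulVec_residual hδ1 hT _
  have hin : restrictTo (z - b) T =
      restrictTo ((z - b) - Φᴴ.mulVec (Φ.mulVec (z - b))) T - restrictTo (Φᴴ.mulVec e) T := by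
    rw [restrictTo_sub (z - b), sub_sub, horth, sub_zero]
  have hout : restrictTo (z - b) Tᶜ = restrictTo z Tᶜ := by
    ext i
    by_cases hi : i ∈ T
    · simp [restrictTo, hi]
    · simp [restrictTo, hi, suppF_subset_iff.1 hbT i hi]
  have h1 := h.l2_restrictTo_sub_le hδ (w := z - b) (A := T) Finset.subset_union_right
    ((suppF_sub_subset z b).trans (Finset.union_subset_union_right hbT)) hzT
  have h2 := h.l2_restrictTo_conjTranspose_mulVec_le hK hδK e hT
  have h3 := l2_sub_le (restrictTo ((z - b) - Φᴴ.mulVec (Φ.mulVec (z - b))) T)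
    (restrictTo (Φᴴ.mulVec e) T)
  have h4 := l2_le_l2_restrictTo_add (z - b) T
  rw [← hin] at h3
  rw [hout] at h4
  linarith

/-- One CoSaMP iteration halves the error for sparse signals, up to a multiple of the noise. -/
theorem CoSaMPStep.l2_sub_le {m N s : ℕ} {Φ : Matrix (Fin m) (Fin N) ℂ}
    (h : HasRIP Φ (4 * s) 0.1) {z : Fin N → ℂ} (hz : Sparse s z) {e u : Fin m → ℂ}
    (hu : u = Φ.mulVec z + e) {a a' : Fin N → ℂ} (ha : Sparse s a)
    (hstep : CoSaMPStep Φ u s a a') :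
    l2 (z - a') ≤ 1 / 2 * l2 (z - a) + 7 * l2 e := by
  obtain ⟨y, hy, hprune⟩ := hstep
  have hδK : (1 : ℝ) + 0.1 ≤ 1.05 ^ 2 := by norm_num
  have hza : Sparse (2 * s) (z - a) := by
    refine .of_suppF_subset (suppF_sub_subset z a) ((Finset.card_union_le _ _).trans ?_)
    rw [two_mul]
    exact add_le_add hz ha
  have hres : u - Φ.mulVec a = Φ.mulVec (z - a) + e := by
    rw [hu, mulVec_sub]
    abel
  rw [hres] at hy
  have hident := h.l2_restrictTo_compl_suppF_le (by norm_num) (by norm_num) hδK hza e hy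
  have hcard : (suppF z ∪ (suppF y ∪ suppF a)).card ≤ 4 * s := by
    have h1 := Finset.card_union_le (suppF z) (suppF y ∪ suppF a)
    have h2 := Finset.card_union_le (suppF y) (suppF a)
    have h3 : (suppF y).card ≤ 2 * s := hy.sparse
    have h4 : (suppF z).card ≤ s := hz
    have h5 : (suppF a).card ≤ s := ha
    omega
  have hestim := h.l2_sub_pinvApply_le (by norm_num) (by norm_num) (by norm_num) hδK hcard e
  rw [← hu] at hestim
  have hmissed : l2 (restrictTo z (suppF y ∪ suppF a)ᶜ) ≤
      l2 (restrictTo (z - a) (suppF y)ᶜ) := by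
    refine l2_mono fun i => ?_
    by_cases hya : y i = 0 <;> by_cases haz : a i = 0 <;>
      simp [restrictTo, mem_suppF, hya, haz]
  have hpruned := hprune.l2_sub_le hz
  set b := pinvApply Φ (suppF y ∪ suppF a) u
  rw [l2_sub_rev b z] at hpruned
  have htri := l2_add_le (z - b) (b - a')
  rw [sub_add_sub_cancel] at htri
  have := l2_nonneg e
  have := l2_nonneg (z - a)
  linarith

/-- **CoSaMP error decay (general signals).**  If `Φ` has restricted isometry constant
`δ_{4s} ≤ 0.1` and `u = Φx + e`, then the CoSaMP approximations satisfy
`‖x − a^k‖₂ ≤ 2^{-k}‖x‖₂ + 20ν`, where `ν` is the unrecoverable energy. -/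
theorem cosamp_error_decay
    {m N : ℕ} (s : ℕ) (hs : 0 < s)
    (Φ : Matrix (Fin m) (Fin N) ℂ) (hΦ : RIC Φ (4 * s) ≤ 0.1)
    (x : Fin N → ℂ) (e : Fin m → ℂ) (u : Fin m → ℂ) (hu : u = Φ.mulVec x + e)
    (a : ℕ → Fin N → ℂ) (ha : CoSaMPSeq Φ u s a)
    (xs : Fin N → ℂ) (hxs : IsSparseApprox s x xs) :
    ∀ k : ℕ, l2 (x - a k) ≤
      (2 : ℝ) ^ (-(k : ℤ)) * l2 x +
        20 * (l2 (x - xs) + (Real.sqrt s)⁻¹ * l1 (x - xs) + l2 e) := by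
  have hrip : HasRIP Φ (4 * s) 0.1 := .of_RIC_le hΦ
  have hnoise : u = Φ.mulVec xs + (Φ.mulVec (x - xs) + e) := by
    rw [hu, ← add_assoc, ← mulVec_add, add_sub_cancel]
  have hsparse : ∀ k, Sparse s (a k) := by
    rintro (_ | k)
    · simp [ha.1, Sparse, suppF]
    · obtain ⟨y, -, hy⟩ := ha.2 k
      exact hy.sparse
  have hsig : ∀ k, l2 (xs - a k) ≤
      (2 : ℝ) ^ (-(k : ℤ)) * l2 xs + 14 * l2 (Φ.mulVec (x - xs) + e) := by
    intro k
    induction k with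
    | zero => simpa [ha.1] using l2_nonneg _
    | succ k ih =>
      have hstep := (ha.2 k).l2_sub_le hrip hxs.sparse hnoise (hsparse k)
      have hpow : (2 : ℝ) ^ (-((k + 1 : ℕ) : ℤ)) = 1 / 2 * (2 : ℝ) ^ (-(k : ℤ)) := by
        rw [Nat.cast_succ, neg_add, zpow_add₀ two_ne_zero, _root_.zpow_neg_one]
        ring
      rw [hpow]
      linarith
  intro k
  have hxsx : l2 xs ≤ l2 x := by
    obtain ⟨T, -, rfl, -⟩ := hxs
    exact l2_restrictTo_le x T
  have henergy := (hrip.mono (by omega : s ≤ 4 * s)).l2_mulVec_le_l2_add_l1 hs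
    (K := 1.05) (by norm_num) (by norm_num) (x - xs)
  have hadd := l2_add_le (Φ.mulVec (x - xs)) e
  have htri := l2_add_le (x - xs) (xs - a k)
  rw [sub_add_sub_cancel] at htri
  have hpow : (2 : ℝ) ^ (-(k : ℤ)) * l2 xs ≤ (2 : ℝ) ^ (-(k : ℤ)) * l2 x := by gcongr
  have htail : 0 ≤ (Real.sqrt s)⁻¹ * l1 (x - xs) :=
    mul_nonneg (inv_nonneg.2 (Real.sqrt_nonneg _)) (l1_nonneg _)
  linarith [hsig k, l2_nonneg (x - xs), l2_nonneg e]
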